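/- arXiv:1407.7294 — 4 statements merged into one kernel-verified Lean document; each statement's English description precedes it below -/
import Mathlib

section
/- Fix δ ∈ (0,1), a budget B > 0, a valuation vector v ∈ (0,1]^n whose entries are integer multiples of δ with δ ≤ v_i ≤ 1 for every i, and a cost vector c ∈ [0,1]^n. For every ε > 0 there exists a price vector p̂ ∈ (0,1]^n such that the set X(v,p̂,B) of utility-maximizing bundles is a singleton {x̂}, and for every price vector p ∈ (0,1]^n and every x ∈ X(v,p,B) one has x̂·(p̂ − c) ≥ x·(p − c) − ε. (That is, there are prices uniquely specifying the consumer's bundle whose profit is within ε of the supremum of the merchant's profit over all prices.) -/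
open Finset

/-- `X v p B` is the set of utility-maximizing bundles for a consumer with
valuation vector `v`, facing prices `p`, with budget `B`. -/
def X {n : ℕ} (v p : Fin n → ℝ) (B : ℝ) : Set (Fin n → ℝ) :=
  {x | (∀ i, 0 ≤ x i ∧ x i ≤ 1) ∧ (∑ i, x i * p i) ≤ B ∧
    ∀ y : Fin n → ℝ, (∀ i, 0 ≤ y i ∧ y i ≤ 1) → (∑ i, y i * p i) ≤ B →
      (∑ i, y i * v i) ≤ (∑ i, x i * v i)}
/-- Total price of the goods ranked strictly below `m`. -/
noncomputable def spent {n : ℕ} (r : Fin n → ℕ) (p : Fin n → ℝ) (m : ℕ) : ℝ :=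
  ∑ j ∈ Finset.univ.filter (fun j => r j < m), p j

/-- Greedy bundle for the ranking `r`. -/
noncomputable def greedy {n : ℕ} (r : Fin n → ℕ) (B : ℝ) (p : Fin n → ℝ) : Fin n → ℝ :=
  fun i => max 0 (min 1 ((B - spent r p (r i)) / p i))

lemma spent_succ {n : ℕ} (r : Fin n → ℕ) (hr : Function.Injective r) (p : Fin n → ℝ)
    (k : Fin n) : spent r p (r k + 1) = spent r p (r k) + p k := by
  unfold spent
  have : Finset.univ.filter (fun j => r j < r k + 1)
      = insert k (Finset.univ.filter (fun j => r j < r k)) := by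
    ext j
    simp only [Finset.mem_filter, Finset.mem_univ, true_and, Finset.mem_insert]
    constructor
    · intro h
      rcases Nat.lt_succ_iff_lt_or_eq.mp h with h | h
      · exact Or.inr h
      · exact Or.inl (hr h)
    · rintro (h | h)
      · subst h; omega
      · omega
  rw [this, Finset.sum_insert (by simp)]
  ring

lemma spent_mono {n : ℕ} (r : Fin n → ℕ) (p : Fin n → ℝ) (hp : ∀ i, 0 < p i)
    {a b : ℕ} (h : a ≤ b) : spent r p a ≤ spent r p b := by
  unfold spent
  apply Finset.sum_le_sum_of_subset_of_nonneg
  · intro j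
    simp only [Finset.mem_filter, Finset.mem_univ, true_and]
    omega
  · intro i _ _
    exact (hp i).le

lemma spent_le {n : ℕ} (r : Fin n → ℕ) (hr : Function.Injective r) (p : Fin n → ℝ)
    (B : ℝ) (hB : 0 < B) (m : ℕ)
    (h : ∀ i, r i < m → spent r p (r i) + p i ≤ B) : spent r p m ≤ B := by
  induction m with
  | zero => simp [spent, hB.le]
  | succ m ih =>
    by_cases hk : ∃ k, r k = m
    · obtain ⟨k, rfl⟩ := hk
      rw [spent_succ r hr]
      exact h k (by omega)
    · push Not at hk
      have : spent r p (m + 1) = spent r p m := by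
        unfold spent
        congr 1
        ext j
        have := hk j
        simp only [Finset.mem_filter, Finset.mem_univ, true_and]
        omega
      rw [this]
      exact ih (fun i hi => h i (by omega))

lemma greedy_range {n : ℕ} (r : Fin n → ℕ) (p : Fin n → ℝ) (B : ℝ) (i : Fin n) :
    0 ≤ greedy r B p i ∧ greedy r B p i ≤ 1 := by
  unfold greedy
  exact ⟨le_max_left _ _, max_le zero_le_one (min_le_left _ _)⟩

lemma greedy_pivot {n : ℕ} (r : Fin n → ℕ) (hr : Function.Injective r) (p : Fin n → ℝ)
    (hp : ∀ i, 0 < p i) (B : ℝ) (hB : 0 < B) :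
    ((∀ i, greedy r B p i = 1) ∧ ∑ i, greedy r B p i * p i ≤ B) ∨
    ∃ k, (∀ i, r i < r k → greedy r B p i = 1) ∧ (∀ i, r k < r i → greedy r B p i = 0) ∧
      ∑ i, greedy r B p i * p i = B := by
  have one : ∀ i, spent r p (r i) + p i ≤ B → greedy r B p i = 1 := by
    intro i hi
    unfold greedy
    have : 1 ≤ (B - spent r p (r i)) / p i := by
      rw [le_div_iff₀ (hp i)]; linarith
    rw [min_eq_left this]; simp
  by_cases hall : ∀ i, spent r p (r i) + p i ≤ B
  · left
    refine ⟨fun i => one i (hall i), ?_⟩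
    have h1 := spent_le r hr p B hB (∑ i, r i + 1) (fun i _ => hall i)
    have h2 : spent r p (∑ i, r i + 1) = ∑ i, p i := by
      unfold spent
      congr 1
      ext j
      have := Finset.single_le_sum (f := r) (fun i _ => Nat.zero_le _) (Finset.mem_univ j)
      simp only [Finset.mem_filter, Finset.mem_univ, true_and, iff_true]
      omega
    rw [h2] at h1
    calc ∑ i, greedy r B p i * p i = ∑ i, p i :=
          Finset.sum_congr rfl (fun i _ => by rw [one i (hall i), one_mul])
      _ ≤ B := h1
  · right
    push Not at hall
    obtain ⟨k0, hk0⟩ := hall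
    obtain ⟨k, hk, hmin⟩ := Finset.exists_min_image
      (Finset.univ.filter (fun i => B < spent r p (r i) + p i)) r ⟨k0, by simpa using hk0⟩
    simp only [Finset.mem_filter, Finset.mem_univ, true_and] at hk hmin
    have hbef : ∀ i, r i < r k → spent r p (r i) + p i ≤ B := by
      intro i hi
      by_contra hc
      have := hmin i (not_le.mp hc)
      omega
    have hS := spent_le r hr p B hB (r k) hbef
    have haft : ∀ i, r k < r i → greedy r B p i = 0 := by
      intro i hi
      have h1 := spent_mono r p hp (Nat.succ_le_of_lt hi)
      rw [Nat.succ_eq_add_one, spent_succ r hr] at h1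
      unfold greedy
      apply max_eq_left
      apply (min_le_right _ _).trans
      apply div_nonpos_of_nonpos_of_nonneg _ (hp i).le
      linarith
    have hkv : greedy r B p k * p k = B - spent r p (r k) := by
      unfold greedy
      have h1 : (B - spent r p (r k)) / p k ≤ 1 := by
        rw [div_le_one (hp k)]; linarith
      have h2 : 0 ≤ (B - spent r p (r k)) / p k := div_nonneg (by linarith) (hp k).le
      rw [min_eq_right h1, max_eq_right h2]
      exact div_mul_cancel₀ _ (hp k).ne'
    refine ⟨k, fun i hi => one i (hbef i hi), haft, ?_⟩
    have h1 : ∑ i, greedy r B p i * p i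
        = spent r (fun i => greedy r B p i * p i) (r k + 1) := by
      unfold spent
      rw [Finset.sum_filter]
      apply Finset.sum_congr rfl
      intro i _
      split_ifs with h
      · rfl
      · rw [haft i (by omega), zero_mul]
    have h2 : spent r (fun i => greedy r B p i * p i) (r k) = spent r p (r k) := by
      unfold spent
      apply Finset.sum_congr rfl
      intro i hi
      simp only [Finset.mem_filter, Finset.mem_univ, true_and] at hi
      simp only [one i (hbef i hi), one_mul]
    rw [h1, spent_succ r hr, h2, hkv]
    ring

/-- Main exchange lemma. -/
lemma exchange {n : ℕ} (r : Fin n → ℕ) (hr : Function.Injective r) (p v : Fin n → ℝ)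
    (hp : ∀ i, 0 < p i) (hv : ∀ i, 0 < v i) (B : ℝ) (hB : 0 < B)
    (hord : ∀ i j, r i < r j → v j / p j ≤ v i / p i) :
    greedy r B p ∈ X v p B ∧ ∀ x ∈ X v p B, x = greedy r B p ∨
      ∃ k, (∀ i, r i < r k → greedy r B p i = 1) ∧ (∀ i, r k < r i → greedy r B p i = 0) ∧
        ∑ i, greedy r B p i * p i = B ∧ ∑ i, x i * p i = B ∧
        ∀ i, v i / p i ≠ v k / p k → x i = greedy r B p i := by
  have hrange := greedy_range r p B
  set y := greedy r B p with hy
  rcases greedy_pivot r hr p hp B hB with ⟨h1, hb⟩ | ⟨k, hbef, haft, hb⟩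
  · rw [← hy] at h1 hb
    have hmem : y ∈ X v p B := by
      refine ⟨hrange, hb, fun z hz _ => Finset.sum_le_sum fun i _ => ?_⟩
      rw [h1 i]
      exact mul_le_mul_of_nonneg_right (hz i).2 (hv i).le
    refine ⟨hmem, fun x hx => Or.inl ?_⟩
    have hle := hx.2.2 y hmem.1 hmem.2.1
    have hterm : ∀ i ∈ Finset.univ, x i * v i ≤ y i * v i := by
      intro i _
      rw [h1 i]
      exact mul_le_mul_of_nonneg_right (hx.1 i).2 (hv i).le
    have heq := (Finset.sum_eq_sum_iff_of_le hterm).mp (le_antisymm (Finset.sum_le_sum hterm) hle)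
    funext i
    exact mul_right_cancel₀ (hv i).ne' (heq i (Finset.mem_univ i))
  · rw [← hy] at hbef haft hb
    set l := v k / p k with hl
    have hlpos : 0 < l := div_pos (hv k) (hp k)
    have hterm : ∀ z : Fin n → ℝ, (∀ i, 0 ≤ z i ∧ z i ≤ 1) → ∀ i ∈ Finset.univ,
        0 ≤ (y i - z i) * (v i - l * p i) := by
      intro z hz i _
      rcases lt_trichotomy (r i) (r k) with h | h | h
      · have := hord i k h
        rw [← hl, le_div_iff₀ (hp i)] at this
        rw [hbef i h]
        exact mul_nonneg (by linarith [(hz i).2]) (by linarith)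
      · have := hr h
        subst this
        rw [hl, div_mul_cancel₀ _ (hp i).ne']
        simp
      · have := hord k i h
        rw [← hl, div_le_iff₀ (hp i)] at this
        rw [haft i h]
        exact mul_nonneg_of_nonpos_of_nonpos (by linarith [(hz i).1]) (by linarith)
    have hdecomp : ∀ z : Fin n → ℝ, ∑ i, y i * v i - ∑ i, z i * v i
        = ∑ i, (y i - z i) * (v i - l * p i) + l * (B - ∑ i, z i * p i) := by
      intro z
      rw [← hb, mul_sub, Finset.mul_sum, Finset.mul_sum, ← Finset.sum_sub_distrib,
        ← Finset.sum_sub_distrib, ← Finset.sum_add_distrib]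
      exact Finset.sum_congr rfl (fun i _ => by ring)
    have hmem : y ∈ X v p B := by
      refine ⟨hrange, hb.le, fun z hz hzB => ?_⟩
      have h1 := Finset.sum_nonneg (hterm z hz)
      have h2 := mul_nonneg hlpos.le (sub_nonneg.mpr hzB)
      linarith [hdecomp z]
    refine ⟨hmem, fun x hx => Or.inr ⟨k, hbef, haft, hb, ?_⟩⟩
    have hle := hx.2.2 y hmem.1 hmem.2.1
    have h1 := Finset.sum_nonneg (hterm x hx.1)
    have h2 := mul_nonneg hlpos.le (sub_nonneg.mpr hx.2.1)
    have hd := hdecomp x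
    have h3 : ∑ i, (y i - x i) * (v i - l * p i) = 0 := by linarith
    have h4 : l * (B - ∑ i, x i * p i) = 0 := by linarith
    have h5 : B - ∑ i, x i * p i = 0 := (mul_eq_zero.mp h4).resolve_left hlpos.ne'
    refine ⟨by linarith, fun i hi => ?_⟩
    have h6 := (Finset.sum_eq_zero_iff_of_nonneg (hterm x hx.1)).mp h3 i (Finset.mem_univ i)
    rcases mul_eq_zero.mp h6 with h | h
    · linarith
    · exfalso
      apply hi
      rw [div_eq_iff (hp i).ne']
      linarith

lemma greedy_unique {n : ℕ} (r : Fin n → ℕ) (hr : Function.Injective r) (p v : Fin n → ℝ)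
    (hp : ∀ i, 0 < p i) (hv : ∀ i, 0 < v i) (B : ℝ) (hB : 0 < B)
    (hord : ∀ i j, r i < r j → v j / p j < v i / p i) :
    X v p B = {greedy r B p} := by
  obtain ⟨hm, hu⟩ := exchange r hr p v hp hv B hB (fun i j h => (hord i j h).le)
  apply Set.eq_singleton_iff_unique_mem.mpr ⟨hm, fun x hx => ?_⟩
  rcases hu x hx with h | ⟨k, -, -, hb, hxb, hne⟩
  · exact h
  have hne' : ∀ i, i ≠ k → x i = greedy r B p i := by
    intro i hi
    apply hne
    rcases lt_or_gt_of_ne (fun h => hi (hr h)) with h | h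
    · exact (hord i k h).ne'
    · exact (hord k i h).ne
  have hk : x k = greedy r B p k := by
    have h := hxb.trans hb.symm
    rw [← Finset.add_sum_erase _ _ (Finset.mem_univ k),
      ← Finset.add_sum_erase _ _ (Finset.mem_univ k),
      Finset.sum_congr rfl (fun i hi => by rw [hne' i (Finset.ne_of_mem_erase hi)])] at h
    exact mul_right_cancel₀ (hp k).ne' (add_right_cancel h)
  funext i
  by_cases hi : i = k
  · rw [hi, hk]
  · exact hne' i hi

lemma greedy_profit {n : ℕ} (r : Fin n → ℕ) (hr : Function.Injective r) (p v c : Fin n → ℝ)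
    (hp : ∀ i, 0 < p i) (hv : ∀ i, 0 < v i) (B : ℝ) (hB : 0 < B)
    (hord : ∀ i j, r i < r j → v j / p j ≤ v i / p i)
    (hord2 : ∀ i j, r i < r j → v j / p j = v i / p i → c i / p i ≤ c j / p j)
    (x : Fin n → ℝ) (hx : x ∈ X v p B) :
    ∑ i, x i * (p i - c i) ≤ ∑ i, greedy r B p i * (p i - c i) := by
  obtain ⟨hm, hu⟩ := exchange r hr p v hp hv B hB hord
  rcases hu x hx with h | ⟨k, hbef, haft, hb, hxb, hne⟩
  · rw [h]
  set y := greedy r B p with hy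
  set m := c k / p k with hmdef
  have hterm : ∀ i ∈ Finset.univ, 0 ≤ (x i - y i) * (c i - m * p i) := by
    intro i _
    by_cases ht : v i / p i = v k / p k
    · rcases lt_trichotomy (r i) (r k) with h | h | h
      · have := hord2 i k h ht.symm
        rw [← hmdef, div_le_iff₀ (hp i)] at this
        rw [hbef i h]
        exact mul_nonneg_of_nonpos_of_nonpos (by linarith [(hx.1 i).2]) (by linarith)
      · have := hr h
        subst this
        rw [hmdef, div_mul_cancel₀ _ (hp i).ne']
        simp
      · have := hord2 k i h ht
        rw [← hmdef, le_div_iff₀ (hp i)] at this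
        rw [haft i h]
        exact mul_nonneg (by linarith [(hx.1 i).1]) (by linarith)
    · rw [hne i ht]; simp
  have h1 := Finset.sum_nonneg hterm
  have h2 : ∑ i, (x i - y i) * (c i - m * p i)
      = (∑ i, y i * (p i - c i) - ∑ i, x i * (p i - c i))
        + (1 - m) * (∑ i, x i * p i - ∑ i, y i * p i) := by
    rw [← Finset.sum_sub_distrib, ← Finset.sum_sub_distrib, Finset.mul_sum,
      ← Finset.sum_add_distrib]
    exact Finset.sum_congr rfl (fun i _ => by ring)
  rw [hb, hxb] at h2
  linarith

lemma exists_rank {n : ℕ} (a b : Fin n → ℝ) : ∃ r : Fin n → ℕ, Function.Injective r ∧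
    (∀ i, r i < n) ∧ (∀ i j, r i < r j → a j ≤ a i) ∧
    (∀ i j, r i < r j → a j = a i → b i ≤ b j) := by
  let f : Fin n → ℝ ×ₗ ℝ := fun i => toLex (-(a i), b i)
  have key : ∀ i j, (((Tuple.sort f).symm i : Fin n) : ℕ) < ((Tuple.sort f).symm j : Fin n) →
      f i ≤ f j := by
    intro i j h
    have := Tuple.monotone_sort f (Fin.le_of_lt (Fin.lt_def.mpr h))
    simpa using this
  refine ⟨fun i => ((Tuple.sort f).symm i : Fin n), ?_, fun i => Fin.isLt _, ?_, ?_⟩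
  · intro i j h
    exact (Tuple.sort f).symm.injective (Fin.ext h)
  · intro i j h
    have := key i j h
    simp only [f, Prod.Lex.toLex_le_toLex] at this
    rcases this with h | h
    · linarith
    · linarith [h.1]
  · intro i j h he
    have := key i j h
    simp only [f, Prod.Lex.toLex_le_toLex] at this
    rcases this with h | h
    · linarith
    · exact h.2

lemma perturb {n : ℕ} (p v c : Fin n → ℝ) (hp : ∀ i, 0 < p i ∧ p i ≤ 1) (hv : ∀ i, 0 < v i)
    (B : ℝ) (hB : 0 < B) (ε : ℝ) (hε : 0 < ε) (x : Fin n → ℝ) (hx : x ∈ X v p B) :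
    ∃ q : Fin n → ℝ, (∀ i, 0 < q i ∧ q i ≤ 1) ∧ ∃ y, X v q B = {y} ∧
      ∑ i, x i * (p i - c i) - ε < ∑ i, y i * (q i - c i) := by
  obtain ⟨r, hr, hrn, h1, h2⟩ := exists_rank (fun i => v i / p i) (fun i => c i / p i)
  have hprof := greedy_profit r hr p v c (fun i => (hp i).1) hv B hB h1 h2 x hx
  let q : ℝ → Fin n → ℝ := fun t i => p i / (1 + t * ((n : ℝ) - r i))
  have hpos : ∀ i, 0 < (n : ℝ) - r i := fun i => sub_pos.mpr (by exact_mod_cast hrn i)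
  have hq0 : q 0 = p := by funext i; simp [q]
  have hqc : ∀ i, ContinuousAt (fun t => q t i) 0 := by
    intro i
    apply ContinuousAt.div (by fun_prop) (by fun_prop)
    simp
  have hgc : ∀ i, ContinuousAt (fun t => greedy r B (q t) i) 0 := by
    intro i
    unfold greedy spent
    refine Filter.Tendsto.max tendsto_const_nhds ?_
    refine Filter.Tendsto.min tendsto_const_nhds ?_
    apply ContinuousAt.div _ (hqc i)
    · rw [hq0]; exact (hp i).1.ne'
    · exact continuousAt_const.sub (tendsto_finsetSum _ (fun j _ => hqc j))
  have hF : ContinuousAt (fun t => ∑ i, greedy r B (q t) i * (q t i - c i)) 0 :=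
    tendsto_finsetSum _ (fun i _ => (hgc i).mul ((hqc i).sub continuousAt_const))
  have hev := hF.eventually (lt_mem_nhds (a := ∑ i, x i * (p i - c i) - ε) (by
    simp only [hq0]; linarith))
  obtain ⟨t, ht, ht0⟩ := ((hev.filter_mono nhdsWithin_le_nhds).and
    (self_mem_nhdsWithin (a := (0:ℝ)) (s := Set.Ioi 0))).exists
  have ht0 : 0 < t := ht0
  have hd : ∀ i, 0 < t * ((n : ℝ) - r i) := fun i => mul_pos ht0 (hpos i)
  have hqpos : ∀ i, 0 < q t i := fun i => div_pos (hp i).1 (by linarith [hd i])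
  refine ⟨q t, fun i => ⟨hqpos i, ?_⟩, greedy r B (q t), ?_, ht⟩
  · simp only [q]
    rw [div_le_one (by linarith [hd i])]
    linarith [hd i, (hp i).2]
  · apply greedy_unique r hr (q t) v hqpos hv B hB
    intro i j hij
    have e : ∀ i, v i / q t i = v i / p i * (1 + t * ((n : ℝ) - r i)) := by
      intro i
      simp only [q]
      rw [div_div_eq_mul_div, mul_div_right_comm]
    rw [e, e]
    have hij' : (r i : ℝ) < r j := by exact_mod_cast hij
    apply mul_lt_mul' (h1 i j hij) _ (by linarith [hd j]) (div_pos (hv i) (hp i).1)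
    have := mul_lt_mul_of_pos_left hij' ht0
    linarith

/-- For δ-discretized valuations there exist prices uniquely specifying
the consumer's bundle whose profit is within ε of the supremum of the merchant's
profit over all prices. -/
theorem stmt0 (n : ℕ) (δ B : ℝ) (hδ : 0 < δ) (hδ1 : δ < 1) (hB : 0 < B)
    (v c : Fin n → ℝ)
    (hv : ∀ i, δ ≤ v i ∧ v i ≤ 1)
    (hvdisc : ∀ i, ∃ m : ℤ, v i = m * δ)
    (hc : ∀ i, 0 ≤ c i ∧ c i ≤ 1) :
    ∀ ε > 0, ∃ phat : Fin n → ℝ, (∀ i, 0 < phat i ∧ phat i ≤ 1) ∧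
      ∃ xhat : Fin n → ℝ, X v phat B = {xhat} ∧
        ∀ p : Fin n → ℝ, (∀ i, 0 < p i ∧ p i ≤ 1) →
          ∀ x ∈ X v p B,
            (∑ i, xhat i * (phat i - c i)) ≥ (∑ i, x i * (p i - c i)) - ε := by
  intro ε hε
  have hv0 : ∀ i, 0 < v i := fun i => lt_of_lt_of_le hδ (hv i).1
  let S : Set ℝ := {s | ∃ p : Fin n → ℝ, (∀ i, 0 < p i ∧ p i ≤ 1) ∧ ∃ x ∈ X v p B,
    s = ∑ i, x i * (p i - c i)}
  have hne : S.Nonempty := by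
    obtain ⟨r, hr, -, h1, -⟩ := exists_rank (fun i => v i / (1:ℝ)) (fun i => (0:ℝ))
    exact ⟨_, fun _ => 1, fun _ => by norm_num, _,
      (exchange r hr (fun _ => 1) v (fun _ => one_pos) hv0 B hB h1).1, rfl⟩
  have hbdd : BddAbove S := by
    refine ⟨B, ?_⟩
    rintro s ⟨p, hp, x, hx, rfl⟩
    refine le_trans (Finset.sum_le_sum fun i _ => ?_) hx.2.1
    exact mul_le_mul_of_nonneg_left (by linarith [(hc i).1]) (hx.1 i).1
  obtain ⟨s, ⟨p, hp, x, hx, rfl⟩, hs⟩ :=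
    exists_lt_of_lt_csSup hne (show sSup S - ε / 2 < sSup S by linarith)
  obtain ⟨q, hq, y, hy, hlt⟩ := perturb p v c hp hv0 B hB (ε / 2) (by linarith) x hx
  refine ⟨q, hq, y, hy, fun p' hp' x' hx' => ?_⟩
  have := le_csSup hbdd (show ∑ i, x' i * (p' i - c i) ∈ S from ⟨p', hp', x', hx', rfl⟩)
  linarith
end

section
/- Fix a budget B > 0, a valuation vector v ∈ (0,1]^n, a price vector p ∈ (0,1]^n, and a cost vector c ∈ [0,1]^n. Let x ∈ X(v,p,B) satisfy x·p = B, and suppose there is a threshold τ > 0 such that: (a) v_i/p_i ≥ τ for every i with x_i > 0; (b) v_i/p_i = τ for every i with 0 < x_i < 1; and (c) v_i ≤ τ for every i with x_i = 0. Define the price vector q by q_i = min(v_i/τ, 1) for every i with x_i > 0 and q_i = 1 for every i with x_i = 0. Then there exists x' ∈ X(v,q,B) with x'_i ≤ x_i for every coordinate i, and consequently x'·(q − c) ≥ x·(p − c). -/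
open Finset

/-- Raising the prices of purchased goods to min(v_i/τ, 1) and of
unpurchased goods to 1 only improves the merchant's profit. -/
theorem stmt2 (n : ℕ) (B : ℝ) (hB : 0 < B)
    (v p c : Fin n → ℝ)
    (hv : ∀ i, 0 < v i ∧ v i ≤ 1)
    (hp : ∀ i, 0 < p i ∧ p i ≤ 1)
    (hc : ∀ i, 0 ≤ c i ∧ c i ≤ 1)
    (x : Fin n → ℝ) (hx : x ∈ X v p B) (hsat : (∑ i, x i * p i) = B)
    (τ : ℝ) (hτ : 0 < τ)
    (ha : ∀ i, 0 < x i → v i / p i ≥ τ)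
    (hb : ∀ i, 0 < x i → x i < 1 → v i / p i = τ)
    (hcc : ∀ i, x i = 0 → v i ≤ τ)
    (q : Fin n → ℝ)
    (hq : ∀ i, (0 < x i → q i = min (v i / τ) 1) ∧ (x i = 0 → q i = 1)) :
    ∃ x' ∈ X v q B, (∀ i, x' i ≤ x i) ∧
      (∑ i, x' i * (q i - c i)) ≥ (∑ i, x i * (p i - c i)) := by
  obtain ⟨hx01, -, -⟩ := hx
  have hτq : ∀ i, 0 < x i → τ * q i ≤ v i := by
    intro i hi
    rw [(hq i).1 hi]
    have h := min_le_left (v i / τ) 1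
    have h2 : τ * (v i / τ) = v i := by field_simp
    nlinarith
  have hpq : ∀ i, 0 < x i → p i ≤ q i := by
    intro i hi
    rw [(hq i).1 hi]
    refine le_min ?_ (hp i).2
    have h := ha i hi
    rw [ge_iff_le, le_div_iff₀ (hp i).1] at h
    rw [le_div_iff₀ hτ]
    linarith
  have hvq : ∀ i, x i < 1 → v i ≤ τ * q i := by
    intro i hi
    rcases (hx01 i).1.eq_or_lt with h0 | h0
    · rw [(hq i).2 h0.symm]
      linarith [hcc i h0.symm]
    · have h := hb i h0 hi
      rw [div_eq_iff (hp i).1.ne'] at h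
      have := hpq i h0
      nlinarith
  have hq0 : ∀ i, 0 < q i := by
    intro i
    rcases (hx01 i).1.eq_or_lt with h0 | h0
    · rw [(hq i).2 h0.symm]; exact one_pos
    · exact lt_of_lt_of_le (hp i).1 (hpq i h0)
  have hxq : B ≤ ∑ i, x i * q i := by
    rw [← hsat]
    refine Finset.sum_le_sum fun i _ => ?_
    rcases (hx01 i).1.eq_or_lt with h0 | h0
    · rw [← h0]; simp
    · exact mul_le_mul_of_nonneg_left (hpq i h0) h0.le
  -- replace a feasible bundle by one below `x` that exhausts the budget
  have key : ∀ y : Fin n → ℝ, (∀ i, 0 ≤ y i ∧ y i ≤ 1) → (∑ i, y i * q i) ≤ B →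
      ∃ w : Fin n → ℝ, (∀ i, 0 ≤ w i ∧ w i ≤ x i) ∧ (∑ i, w i * q i) = B ∧
        (∑ i, y i * v i) ≤ ∑ i, w i * v i := by
    intro y hy hyB
    obtain ⟨m, hm⟩ : ∃ m : Fin n → ℝ, ∀ i, m i = min (y i) (x i) := ⟨_, fun _ => rfl⟩
    have hmy : ∀ i, m i ≤ y i := fun i => by rw [hm]; exact min_le_left _ _
    have hmx : ∀ i, m i ≤ x i := fun i => by rw [hm]; exact min_le_right _ _
    have hm0 : ∀ i, 0 ≤ m i := fun i => by rw [hm]; exact le_min (hy i).1 (hx01 i).1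
    have hmB : ∑ i, m i * q i ≤ ∑ i, y i * q i :=
      Finset.sum_le_sum fun i _ => mul_le_mul_of_nonneg_right (hmy i) (hq0 i).le
    obtain ⟨t, ht0, ht1, ht⟩ : ∃ t : ℝ, 0 ≤ t ∧ t ≤ 1 ∧
        t * (∑ i, x i * q i - ∑ i, m i * q i) = B - ∑ i, m i * q i := by
      by_cases hD : ∑ i, x i * q i - ∑ i, m i * q i = 0
      · exact ⟨0, le_rfl, zero_le_one, by linarith⟩
      · have hD' : 0 < ∑ i, x i * q i - ∑ i, m i * q i :=
          lt_of_le_of_ne (by linarith) (Ne.symm hD)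
        refine ⟨(B - ∑ i, m i * q i) / (∑ i, x i * q i - ∑ i, m i * q i),
          div_nonneg (by linarith) hD'.le, ?_, div_mul_cancel₀ _ hD⟩
        rw [div_le_one hD']
        linarith
    have hwB : ∑ i, (m i + t * (x i - m i)) * q i = B := by
      have : ∑ i, (m i + t * (x i - m i)) * q i
          = ∑ i, m i * q i + t * (∑ i, x i * q i - ∑ i, m i * q i) := by
        rw [← Finset.sum_sub_distrib, Finset.mul_sum, ← Finset.sum_add_distrib]
        exact Finset.sum_congr rfl fun i _ => by ring
      rw [this, ht]; ring
    refine ⟨fun i => m i + t * (x i - m i), fun i => ⟨?_, ?_⟩, hwB, ?_⟩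
    · have := mul_nonneg ht0 (sub_nonneg.2 (hmx i))
      linarith [hm0 i]
    · nlinarith [hmx i]
    · have h1 : ∑ i, (y i * v i - τ * (y i * q i)) ≤
          ∑ i, ((m i + t * (x i - m i)) * v i - τ * ((m i + t * (x i - m i)) * q i)) := by
        refine Finset.sum_le_sum fun i _ => ?_
        have h2 : (y i - m i) * (v i - τ * q i) ≤ 0 := by
          rcases le_total (y i) (x i) with h | h
          · rw [hm i, min_eq_left h]; simp
          · rcases (hx01 i).2.lt_or_eq with h1 | h1
            · exact mul_nonpos_of_nonneg_of_nonpos (sub_nonneg.2 (hmy i))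
                (sub_nonpos.2 (hvq i h1))
            · have : m i = y i := by
                rw [hm i, min_eq_left]; rw [h1]; exact (hy i).2
              rw [this]; simp
        have h3 : 0 ≤ t * (x i - m i) * (v i - τ * q i) := by
          rcases (hx01 i).1.eq_or_lt with h0 | h0
          · have : m i = x i := le_antisymm (hmx i) (by rw [← h0]; exact hm0 i)
            rw [this]; simp
          · exact mul_nonneg (mul_nonneg ht0 (sub_nonneg.2 (hmx i)))
              (sub_nonneg.2 (hτq i h0))
        linarith
      rw [Finset.sum_sub_distrib, Finset.sum_sub_distrib, ← Finset.mul_sum, ← Finset.mul_sum,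
        hwB] at h1
      have := mul_le_mul_of_nonneg_left hyB hτ.le
      linarith
  let K : Set (Fin n → ℝ) := Set.Icc 0 x ∩ {w | ∑ i, w i * q i = B}
  have hK : IsCompact K := by
    refine isCompact_Icc.inter_right (isClosed_eq ?_ continuous_const)
    fun_prop
  have hKne : K.Nonempty := by
    obtain ⟨w, hw, hwB, -⟩ := key (fun _ => 0) (fun i => by simp) (by simpa using hB.le)
    exact ⟨w, ⟨fun i => (hw i).1, fun i => (hw i).2⟩, hwB⟩
  obtain ⟨z, ⟨⟨hz0, hzx⟩, hzB⟩, hzmax⟩ := hK.exists_isMaxOn hKne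
    (f := fun w => ∑ i, w i * v i) (by fun_prop)
  have hzB' : ∑ i, z i * q i = B := hzB
  refine ⟨z, ⟨fun i => ⟨hz0 i, (hzx i).trans (hx01 i).2⟩, hzB'.le, ?_⟩, hzx, ?_⟩
  · intro y hy hyB
    obtain ⟨w, hw, hwB, hyw⟩ := key y hy hyB
    exact hyw.trans (hzmax (show w ∈ K from ⟨⟨fun i => (hw i).1, fun i => (hw i).2⟩, hwB⟩))
  · simp only [mul_sub, Finset.sum_sub_distrib]
    rw [hzB', hsat]
    have : ∑ i, z i * c i ≤ ∑ i, x i * c i :=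
      Finset.sum_le_sum fun i _ => mul_le_mul_of_nonneg_right (hzx i) (hc i).1
    linarith
end

section
/- Fix a budget B > 0, a valuation vector v ∈ (0,1]^n, and a price vector p ∈ (0,1]^n. Let x, y ∈ X(v,p,B), and let i be a good whose bang-per-buck ratio is not tied with any other good, i.e., v_i/p_i ≠ v_j/p_j for all j ≠ i. Then x_i = y_i. (Any two utility-maximizing bundles agree on all goods whose ratios are untied.) -/
open Finset

theorem exch {n : ℕ} (v p : Fin n → ℝ) (B : ℝ) (hp : ∀ i, 0 < p i ∧ p i ≤ 1)
    (z : Fin n → ℝ) (hz : z ∈ X v p B) (j k : Fin n) (h : v k / p k < v j / p j)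
    (hk : 0 < z k) : z j = 1 := by
  obtain ⟨hb, hB, ho⟩ := hz
  by_contra hne
  have hj : z j < 1 := lt_of_le_of_ne (hb j).2 hne
  have hpj := (hp j).1
  have hpk := (hp k).1
  have hjk : j ≠ k := by
    rintro rfl
    exact lt_irrefl _ h
  rw [div_lt_div_iff₀ hpk hpj] at h
  obtain ⟨e, he, he1, he2⟩ : ∃ e : ℝ, 0 < e ∧ e * p j ≤ z k ∧ e * p k ≤ 1 - z j := by
    refine ⟨min (z k / p j) ((1 - z j) / p k),
      lt_min (div_pos hk hpj) (div_pos (by linarith) hpk), ?_, ?_⟩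
    · rw [← le_div_iff₀ hpj]
      exact min_le_left _ _
    · rw [← le_div_iff₀ hpk]
      exact min_le_right _ _
  have hsum : ∀ c : Fin n → ℝ,
      ∑ l, (z l + (if l = j then e * p k else 0) - (if l = k then e * p j else 0)) * c l
        = ∑ l, z l * c l + e * p k * c j - e * p j * c k := by
    intro c
    simp [add_mul, sub_mul, Finset.sum_add_distrib, Finset.sum_sub_distrib, ite_mul]
  have h1 : 0 < e * p k := mul_pos he hpk
  have h2 : 0 < e * p j := mul_pos he hpj
  have := ho (fun l => z l + (if l = j then e * p k else 0) - (if l = k then e * p j else 0))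
    (by
      intro l
      have := hb l
      by_cases hl : l = j
      · subst hl
        simp only [if_true, if_neg hjk]
        constructor <;> linarith
      · by_cases hl' : l = k
        · subst hl'
          simp only [if_true, if_neg hl]
          constructor <;> linarith
        · simp only [if_neg hl, if_neg hl']
          constructor <;> linarith)
    (by
      rw [hsum]
      nlinarith)
  rw [hsum] at this
  nlinarith [mul_pos he (sub_pos.2 h)]

theorem not_lt_aux {n : ℕ} (B : ℝ) (v p : Fin n → ℝ)
    (hv : ∀ i, 0 < v i ∧ v i ≤ 1) (hp : ∀ i, 0 < p i ∧ p i ≤ 1)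
    (x y : Fin n → ℝ) (hx : x ∈ X v p B) (hy : y ∈ X v p B)
    (i : Fin n) (huntied : ∀ j : Fin n, j ≠ i → v i / p i ≠ v j / p j) :
    ¬ x i < y i := by
  intro hlt
  have hsum : ∀ c : Fin n → ℝ, ∑ l, ((x l + y l) / 2) * c l
      = (∑ l, x l * c l + ∑ l, y l * c l) / 2 := by
    intro c
    rw [← Finset.sum_add_distrib, Finset.sum_div]
    exact Finset.sum_congr rfl fun l _ => by ring
  have hz : (fun l => (x l + y l) / 2) ∈ X v p B := by
    refine ⟨fun l => ?_, ?_, fun w hw hwB => ?_⟩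
    · have := hx.1 l
      have := hy.1 l
      constructor <;> dsimp only <;> linarith
    · rw [hsum]
      linarith [hx.2.1, hy.2.1]
    · rw [hsum]
      linarith [hx.2.2 w hw hwB, hy.2.2 w hw hwB]
  have hagree : ∀ j, j ≠ i → x j = y j := by
    intro j hj
    have hxj := hx.1 j
    have hyj := hy.1 j
    have hxi := hx.1 i
    have hyi := hy.1 i
    rcases lt_or_gt_of_ne (huntied j hj) with h | h
    · have h1 := exch v p B hp _ hz j i h (by linarith)
      linarith
    · by_contra hne
      have hpos : 0 < (x j + y j) / 2 := by
        by_contra h0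
        exact hne (by linarith)
      have h1 := exch v p B hp _ hz i j h hpos
      linarith
  have h1 : ∑ l, x l * v l < ∑ l, y l * v l := by
    refine Finset.sum_lt_sum (fun l _ => ?_)
      ⟨i, Finset.mem_univ i, mul_lt_mul_of_pos_right hlt (hv i).1⟩
    by_cases hl : l = i
    · subst hl
      exact (mul_lt_mul_of_pos_right hlt (hv l).1).le
    · rw [hagree l hl]
  linarith [hx.2.2 y hy.1 hy.2.1]

/-- Any two utility-maximizing bundles agree on every good whose
bang-per-buck ratio is untied. -/
theorem stmt10 (n : ℕ) (B : ℝ) (hB : 0 < B)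
    (v p : Fin n → ℝ)
    (hv : ∀ i, 0 < v i ∧ v i ≤ 1)
    (hp : ∀ i, 0 < p i ∧ p i ≤ 1)
    (x y : Fin n → ℝ) (hx : x ∈ X v p B) (hy : y ∈ X v p B)
    (i : Fin n) (huntied : ∀ j : Fin n, j ≠ i → v i / p i ≠ v j / p j) :
    x i = y i := by
  exact le_antisymm
    (not_lt.1 (not_lt_aux B v p hv hp y x hy hx i huntied))
    (not_lt.1 (not_lt_aux B v p hv hp x y hx hy i huntied))
end

section
/- Fix a budget B > 0 and a valuation vector v ∈ (0,1]^n, and let k be a good such that B > Σ_{j ≠ k} min(v_j/v_k, 1) (i.e., the budget exceeds the total cost of all goods other than k at the price vector p^{(k)} with p^{(k)}_j = min(v_j/v_k, 1)). Then for every price vector q ∈ (0,1]^n and every y ∈ X(v,q,B), one has y_i > 0 for every good i with v_i ≥ v_k. (Every good at least as valued as good k is purchased under every price vector.) -/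
open Finset

/-- If the budget exceeds the total cost of all goods other than k
at prices p^{(k)}, then every good at least as valued as k is purchased under
every price vector. -/
theorem stmt11 (n : ℕ) (B : ℝ) (hB : 0 < B)
    (v : Fin n → ℝ)
    (hv : ∀ i, 0 < v i ∧ v i ≤ 1)
    (k : Fin n)
    (hBk : B > ∑ j ∈ Finset.univ.erase k, min (v j / v k) 1) :
    ∀ q : Fin n → ℝ, (∀ i, 0 < q i ∧ q i ≤ 1) →
      ∀ y ∈ X v q B, ∀ i : Fin n, v i ≥ v k → y i > 0 := by
  intro q hq y hy i hi
  obtain ⟨hy1, hy2, hy3⟩ := hy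
  by_contra hcon
  have hyi : y i = 0 := le_antisymm (not_lt.mp hcon) (hy1 i).1
  have hsum : ∀ (w : Fin n → ℝ) (j : Fin n) (a b : ℝ),
      ∑ l, (y l + (if l = i then a else 0) - (if l = j then b else 0)) * w l
        = ∑ l, y l * w l + a * w i - b * w j := by
    intro w j a b
    simp [add_mul, sub_mul, Finset.sum_add_distrib, Finset.sum_sub_distrib, ite_mul]
  have hswap : ∀ j, j ≠ i → 0 < y j → q j * v i ≤ v j * q i := by
    intro j hj hyj
    by_contra hlt
    push Not at hlt
    have h := hy3 (fun l => y l + (if l = i then y j * q j else 0)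
      - (if l = j then y j * q i else 0)) ?_ ?_
    · simp only [hsum] at h
      nlinarith [mul_pos hyj (sub_pos.mpr hlt)]
    · intro l
      by_cases hli : l = i
      · subst hli
        simp only [if_true, if_neg (Ne.symm hj), hyi]
        constructor
        · nlinarith [mul_pos hyj (hq j).1]
        · nlinarith [(hq j).1, (hq j).2, (hy1 j).2]
      · by_cases hlj : l = j
        · subst hlj
          simp only [if_true, if_neg hli]
          constructor
          · nlinarith [(hq i).2]
          · nlinarith [mul_pos hyj (hq i).1, (hy1 l).2]
        · simpa [hli, hlj] using hy1 l
    · simp only [hsum]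
      linarith [mul_right_comm (y j) (q j) (q i)]
  have hcost : ∑ l, y l * q l ≤ ∑ l ∈ Finset.univ.erase i, min (v l / v k) 1 := by
    rw [← Finset.add_sum_erase _ _ (Finset.mem_univ i), hyi, zero_mul, zero_add]
    apply Finset.sum_le_sum
    intro j hj
    have hj' := Finset.ne_of_mem_erase hj
    have hd : 0 < v j / v k := div_pos (hv j).1 (hv k).1
    rcases (hy1 j).1.eq_or_lt with h0 | h0
    · rw [← h0, zero_mul]
      exact le_min hd.le zero_le_one
    · have hs := hswap j hj' h0
      have h1 : y j * q j ≤ q j := by nlinarith [(hy1 j).2, (hq j).1]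
      refine h1.trans (le_min ?_ (hq j).2)
      rw [le_div_iff₀ (hv k).1]
      nlinarith [(hq j).1, (hq i).2, (hv j).1]
  have heq : ∑ l ∈ Finset.univ.erase i, min (v l / v k) 1
      = ∑ l ∈ Finset.univ.erase k, min (v l / v k) 1 := by
    have e1 := Finset.add_sum_erase Finset.univ (fun l => min (v l / v k) 1) (Finset.mem_univ i)
    have e2 := Finset.add_sum_erase Finset.univ (fun l => min (v l / v k) 1) (Finset.mem_univ k)
    have m1 : min (v i / v k) 1 = 1 := min_eq_right ((one_le_div (hv k).1).mpr hi)
    have m2 : min (v k / v k) 1 = 1 := by rw [div_self (hv k).1.ne', min_self]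
    simp only [m1] at e1
    simp only [m2] at e2
    linarith
  have hlt : ∑ l, y l * q l < B := by linarith
  obtain ⟨t, ht0, ht1, htB⟩ : ∃ t : ℝ, 0 < t ∧ t ≤ 1 ∧ t ≤ B - ∑ l, y l * q l :=
    ⟨min 1 (B - ∑ l, y l * q l), lt_min one_pos (sub_pos.mpr hlt), min_le_left _ _,
      min_le_right _ _⟩
  have h := hy3 (fun l => y l + (if l = i then t else 0) - (if l = i then 0 else 0)) ?_ ?_
  · rw [hsum] at h
    nlinarith [mul_pos ht0 (hv i).1]
  · intro l
    by_cases hli : l = i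
    · subst hli
      simp [hyi, ht0.le, ht1]
    · simpa [hli] using hy1 l
  · rw [hsum]
    nlinarith [(hq i).2]
end
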